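/- (Equivalence of the calibration and equalization problems, Lemma 2) If z* ∈ ℝ^d is a global minimizer of the equalization loss f (with initialization z0) and P* ∈ ℝ^{d×d} is a global minimizer of the calibration loss L (with initialization P0), then P0 · z* = P* · z0. -/

import Mathlib

open Matrix

/-- The regularized least-squares loss with weight `c`, penalized directions `w` and
initialization `x₀`. -/
def penalizedLoss {n ι : Type*} [Fintype n] [Fintype ι] (c : ℝ) (w : ι → n → ℝ)
    (x₀ x : n → ℝ) : ℝ :=
  (∑ i, (x i - x₀ i) ^ 2) + c * ∑ s, (x ⬝ᵥ w s) ^ 2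

theorem eq_zero_of_forall_linear_add_quadratic_nonneg {a b : ℝ}
    (h : ∀ t : ℝ, 0 ≤ t * a + t ^ 2 * b) : a = 0 := by
  have hdisc := discrim_le_zero (a := b) (b := a) (c := 0) fun t => by linarith [h t]
  simp only [discrim] at hdisc
  nlinarith [sq_nonneg a]

theorem penalizedLoss_add_smul {n ι : Type*} [Fintype n] [Fintype ι] (c : ℝ)
    (w : ι → n → ℝ) (x₀ x y : n → ℝ) (t : ℝ) :
    penalizedLoss c w x₀ (x + t • y) = penalizedLoss c w x₀ x +
      (t * (2 * ((x - x₀) ⬝ᵥ y + c * ∑ s, (x ⬝ᵥ w s) * (y ⬝ᵥ w s))) +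
        t ^ 2 * (y ⬝ᵥ y + c * ∑ s, (y ⬝ᵥ w s) ^ 2)) := by
  have h₁ : ∑ i, ((x + t • y) i - x₀ i) ^ 2 =
      ∑ i, (x i - x₀ i) ^ 2 + 2 * t * ((x - x₀) ⬝ᵥ y) + t ^ 2 * (y ⬝ᵥ y) := by
    simp only [dotProduct, Finset.mul_sum, ← Finset.sum_add_distrib, Pi.add_apply,
      Pi.smul_apply, Pi.sub_apply, smul_eq_mul]
    exact Finset.sum_congr rfl fun i _ => by ring
  have h₂ : ∑ s, ((x + t • y) ⬝ᵥ w s) ^ 2 =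
      ∑ s, (x ⬝ᵥ w s) ^ 2 + 2 * t * ∑ s, (x ⬝ᵥ w s) * (y ⬝ᵥ w s) +
        t ^ 2 * ∑ s, (y ⬝ᵥ w s) ^ 2 := by
    simp only [add_dotProduct, smul_dotProduct, smul_eq_mul, Finset.mul_sum,
      ← Finset.sum_add_distrib]
    exact Finset.sum_congr rfl fun s _ => by ring
  simp only [penalizedLoss, h₁, h₂]
  ring

/-- The first-order optimality condition for `penalizedLoss`, in weak form. -/
theorem penalizedLoss_stationary {n ι : Type*} [Fintype n] [Fintype ι] {c : ℝ}
    {w : ι → n → ℝ} {x₀ x : n → ℝ}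
    (hx : ∀ y, penalizedLoss c w x₀ x ≤ penalizedLoss c w x₀ y) (y : n → ℝ) :
    (x - x₀) ⬝ᵥ y + c * ∑ s, (x ⬝ᵥ w s) * (y ⬝ᵥ w s) = 0 := by
  have h := eq_zero_of_forall_linear_add_quadratic_nonneg fun t => by
    have ht := hx (x + t • y)
    rw [penalizedLoss_add_smul] at ht
    exact (le_add_iff_nonneg_right _).mp ht
  linarith

/-- Minimizers of `penalizedLoss` depend on the initialization through a symmetric operator. -/
theorem dotProduct_comm_of_penalizedLoss_minimizers {n ι : Type*} [Fintype n] [Fintype ι]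
    {c : ℝ} {w : ι → n → ℝ} {x₀ x y₀ y : n → ℝ}
    (hx : ∀ u, penalizedLoss c w x₀ x ≤ penalizedLoss c w x₀ u)
    (hy : ∀ u, penalizedLoss c w y₀ y ≤ penalizedLoss c w y₀ u) :
    x₀ ⬝ᵥ y = x ⬝ᵥ y₀ := by
  have h₁ := penalizedLoss_stationary hx y
  have h₂ := penalizedLoss_stationary hy x
  simp only [mul_comm (y ⬝ᵥ w _)] at h₂
  rw [sub_dotProduct] at h₁ h₂
  rw [dotProduct_comm y x, dotProduct_comm y₀ x] at h₂
  linarith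

/-- If a matrix minimizes a sum of functions of its rows, then each row minimizes its summand. -/
theorem row_minimizer_of_sum_minimizer {m n : Type*} [Fintype m] [DecidableEq m]
    {g : m → (n → ℝ) → ℝ} {P : Matrix m n ℝ}
    (hP : ∀ Q : Matrix m n ℝ, ∑ i, g i (P i) ≤ ∑ i, g i (Q i)) (i : m) (u : n → ℝ) :
    g i (P i) ≤ g i u := by
  have h := hP (P.updateRow i u)
  rw [← Finset.add_sum_erase _ _ (Finset.mem_univ i),
    ← Finset.add_sum_erase _ _ (Finset.mem_univ i), updateRow_self,
    Finset.sum_congr rfl fun j hj => by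
      rw [← updateRow_ne (M := P) (b := u) (Finset.ne_of_mem_erase hj)]] at h
  exact le_of_add_le_add_right h

/-- (Equivalence of the calibration and equalization problems, Lemma 2) If z*
minimizes the equalization loss f and P* minimizes the calibration loss L,
then P0 · z* = P* · z0. -/
theorem stmt_12 {d : ℕ} (hd : 1 ≤ d) {ι : Type} [Fintype ι] [Nonempty ι]
    (z₁ z₂ : ι → Fin d → ℝ) (lam : ℝ) (hlam : 0 ≤ lam)
    (D M P0 : Matrix (Fin d) (Fin d) ℝ)
    (hD : D = ∑ s : ι, vecMulVec (z₁ s - z₂ s) (z₁ s - z₂ s))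
    (hM : M = 1 + (lam / (Fintype.card ι : ℝ)) • D)
    (z0 : Fin d → ℝ)
    (L : Matrix (Fin d) (Fin d) ℝ → ℝ)
    (hL : ∀ P, L P = (∑ i, ∑ j, ((P - P0) i j) ^ 2) +
      (lam / (Fintype.card ι : ℝ)) *
        ∑ s : ι, ∑ i, (P.mulVec (z₁ s - z₂ s) i) ^ 2)
    (f : (Fin d → ℝ) → ℝ)
    (hf : ∀ z, f z = (∑ i, (z i - z0 i) ^ 2) +
      (lam / (Fintype.card ι : ℝ)) * ∑ s : ι, (z ⬝ᵥ z₁ s - z ⬝ᵥ z₂ s) ^ 2)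
    (zstar : Fin d → ℝ) (hzstar : ∀ z, f zstar ≤ f z)
    (Pstar : Matrix (Fin d) (Fin d) ℝ) (hPstar : ∀ P, L Pstar ≤ L P) :
    P0.mulVec zstar = Pstar.mulVec z0 := by
  have hL' : ∀ P, L P = ∑ i, penalizedLoss (lam / (Fintype.card ι : ℝ))
      (fun s => z₁ s - z₂ s) (P0 i) (P i) := fun P => by
    rw [hL, Finset.sum_comm (s := (Finset.univ : Finset ι))]
    simp only [penalizedLoss, Finset.sum_add_distrib, ← Finset.mul_sum, Matrix.sub_apply,
      mulVec]
  have hf' : ∀ z, f z = penalizedLoss (lam / (Fintype.card ι : ℝ))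
      (fun s => z₁ s - z₂ s) z0 z := fun z => by
    simp only [hf, penalizedLoss, dotProduct_sub]
  simp only [hL'] at hPstar
  simp only [hf'] at hzstar
  funext i
  exact dotProduct_comm_of_penalizedLoss_minimizers
    (row_minimizer_of_sum_minimizer hPstar i) hzstar
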